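/- The map Φ sending an interval poset P with n minimal elements to the dissection of the convex (n+1)-gon with diagonal set {(a, b+1) : [a,b] is a non-minimal, non-maximal element of P} is a bijection onto the set of diagonally framed dissections of the convex (n+1)-gon containing no quadrilateral face. -/

import Mathlib

/-- A set of values in `Fin n` is consecutive if it is closed under betweenness. -/
def Consec {n : ℕ} (S : Finset (Fin n)) : Prop :=
  ∀ ⦃x y z : Fin n⦄, x ∈ S → z ∈ S → x ≤ y → y ≤ z → y ∈ S

/-- `I` is an interval of the permutation `π` if both `I` and its preimage under `π`
are sets of consecutive integers. -/
def IsInterval {n : ℕ} (π : Equiv.Perm (Fin n)) (I : Finset (Fin n)) : Prop :=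
  Consec I ∧ Consec (I.image π.symm)

/-- The 1-based integer interval `[a,b]` viewed inside `Fin n`
(the element `x : Fin n` represents the value `x.val + 1`). -/
def ivl (n a b : ℕ) : Finset (Fin n) :=
  Finset.univ.filter (fun x => a ≤ x.val + 1 ∧ x.val + 1 ≤ b)

/-- Outer edge of the convex m-gon with vertices 1,...,m. -/
def OuterEdge (m : ℕ) (p : ℕ × ℕ) : Prop :=
  (1 ≤ p.1 ∧ p.2 = p.1 + 1 ∧ p.2 ≤ m) ∨ (p.1 = 1 ∧ p.2 = m)

/-- A (non-degenerate) diagonal of the convex m-gon with vertices 1,...,m. -/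
def IsDiag (m : ℕ) (p : ℕ × ℕ) : Prop :=
  1 ≤ p.1 ∧ p.1 + 1 < p.2 ∧ p.2 ≤ m ∧ ¬ (p.1 = 1 ∧ p.2 = m)

/-- A dissection of the convex m-gon: a set of diagonals. -/
def Dissection (m : ℕ) (D : Set (ℕ × ℕ)) : Prop :=
  ∀ p ∈ D, IsDiag m p

/-- Two chords of a convex polygon cross iff their endpoints interleave. -/
def Cross (p q : ℕ × ℕ) : Prop :=
  (p.1 < q.1 ∧ q.1 < p.2 ∧ p.2 < q.2) ∨ (q.1 < p.1 ∧ p.1 < q.2 ∧ q.2 < p.2)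

/-- A chord is an edge of the graph of the dissection: a diagonal of D or an outer edge. -/
def EdgeOf (m : ℕ) (D : Set (ℕ × ℕ)) (p : ℕ × ℕ) : Prop :=
  p ∈ D ∨ OuterEdge m p

/-- Vertices u and v are joined by an edge of the graph of the dissection. -/
def EdgeBtw (m : ℕ) (D : Set (ℕ × ℕ)) (u v : ℕ) : Prop :=
  EdgeOf m D (min u v, max u v)

/-- A dissection is diagonally framed if the four sides of every pair of crossing
diagonals are edges of the graph of the dissection. -/
def DiagFramed (m : ℕ) (D : Set (ℕ × ℕ)) : Prop :=
  ∀ a b c d : ℕ, a < b → b < c → c < d → (a, c) ∈ D → (b, d) ∈ D →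
    EdgeOf m D (a, b) ∧ EdgeOf m D (b, c) ∧ EdgeOf m D (c, d) ∧ EdgeOf m D (a, d)

/-- The interval poset of π encoded by endpoint pairs: (a,b) with 1 ≤ a ≤ b ≤ n such
that [a,b] is an interval of π. -/
def PosetPairs (n : ℕ) (π : Equiv.Perm (Fin n)) : Set (ℕ × ℕ) :=
  {p | 1 ≤ p.1 ∧ p.1 ≤ p.2 ∧ p.2 ≤ n ∧ IsInterval π (ivl n p.1 p.2)}

/-- The set of interval posets (so encoded) with n minimal elements. -/
def IntervalPosets (n : ℕ) : Set (Set (ℕ × ℕ)) :=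
  {P | ∃ π : Equiv.Perm (Fin n), P = PosetPairs n π}

/-- Φ sends each non-minimal (non-singleton) and non-maximal element [a,b] of the
poset to the diagonal (a, b+1) of the convex (n+1)-gon. -/
def Phi (n : ℕ) (P : Set (ℕ × ℕ)) : Set (ℕ × ℕ) :=
  {q | ∃ a b : ℕ, (a, b) ∈ P ∧ a < b ∧ ¬ (a = 1 ∧ b = n) ∧ q = (a, b + 1)}

/-- No diagonal of D passes through the interior of the quadrilateral a < b < c < d. -/
def NoDiagInsideQuad (D : Set (ℕ × ℕ)) (a b c d : ℕ) : Prop :=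
  ¬ ∃ p ∈ D, Cross p (a, b) ∨ Cross p (b, c) ∨ Cross p (c, d) ∨ Cross p (a, d) ∨
      p = (a, c) ∨ p = (b, d)

/-- The dissection D of the convex m-gon has a quadrilateral face. -/
def HasQuadFace (m : ℕ) (D : Set (ℕ × ℕ)) : Prop :=
  ∃ a b c d : ℕ, 1 ≤ a ∧ a < b ∧ b < c ∧ c < d ∧ d ≤ m ∧
    EdgeOf m D (a, b) ∧ EdgeOf m D (b, c) ∧ EdgeOf m D (c, d) ∧ EdgeOf m D (a, d) ∧
    NoDiagInsideQuad D a b c d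

/-- The labels `f` of the positions of `S` lying in `[u, v)` are consecutive among all labels
of `S`. -/
def ConvexBlock (S : Finset ℕ) (f : ℕ → ℤ) (u v : ℕ) : Prop :=
  ∀ x ∈ S, ∀ y ∈ S, ∀ z ∈ S, u ≤ x → x < v → u ≤ z → z < v → f x < f y → f y < f z →
    u ≤ y ∧ y < v

/-- The polygon with vertex set `V`, extreme vertices `l < r` and edge relation `E` is
diagonally framed and has no quadrilateral face. -/
structure FramedPolygon (V : Finset ℕ) (l r : ℕ) (E : ℕ → ℕ → Prop) : Prop where
  left_mem : l ∈ V
  right_mem : r ∈ V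
  lt : l < r
  bounds : ∀ x ∈ V, l ≤ x ∧ x ≤ r
  top : E l r
  adj : ∀ u ∈ V, ∀ v ∈ V, u < v → (∀ w ∈ V, w ≤ u ∨ v ≤ w) → E u v
  framed : ∀ a ∈ V, ∀ b ∈ V, ∀ c ∈ V, ∀ d ∈ V, a < b → b < c → c < d → E a c → E b d →
    E a b ∧ E b c ∧ E c d ∧ E a d
  noQuad : ∀ a ∈ V, ∀ b ∈ V, ∀ c ∈ V, ∀ d ∈ V, a < b → b < c → c < d →
    E a b → E b c → E c d → E a d → E a c ∨ E b d ∨ ∃ p ∈ V, ∃ q ∈ V, p < q ∧ E p q ∧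
      (Cross (p, q) (a, b) ∨ Cross (p, q) (b, c) ∨ Cross (p, q) (c, d) ∨ Cross (p, q) (a, d))

/-- The labelling `f` of the sides of the polygon (each side given by its left endpoint)
has exactly the edges of `E` as consecutive blocks. -/
structure Realizes (V : Finset ℕ) (r : ℕ) (E : ℕ → ℕ → Prop) (f : ℕ → ℤ) : Prop where
  inj : ∀ x ∈ V, ∀ y ∈ V, x < r → y < r → f x = f y → x = y
  iff : ∀ u ∈ V, ∀ v ∈ V, u < v → (E u v ↔ ConvexBlock (V.filter (· < r)) f u v)

namespace ConvexBlock

variable {S : Finset ℕ} {f : ℕ → ℤ} {a b c d : ℕ}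

theorem neg (h : ConvexBlock S f a b) : ConvexBlock S (fun x => - f x) a b := by
  intro x hx y hy z hz h1 h2 h3 h4 h5 h6
  exact h z hz y hy x hx h3 h4 h1 h2 (by simpa using h6) (by simpa using h5)

theorem inter (h1 : ConvexBlock S f a c) (h2 : ConvexBlock S f b d) (hab : a ≤ b)
    (hcd : c ≤ d) : ConvexBlock S f b c := by
  intro x hx y hy z hz _ _ _ _ _ _
  have := h1 x hx y hy z hz (by omega) (by omega) (by omega) (by omega) (by omega) (by omega)
  have := h2 x hx y hy z hz (by omega) (by omega) (by omega) (by omega) (by omega) (by omega)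
  omega

theorem union (hf : Set.InjOn f S) (h1 : ConvexBlock S f a c) (h2 : ConvexBlock S f b d)
    (hb : b ∈ S) (hab : a ≤ b) (hbc : b < c) (hcd : c ≤ d) : ConvexBlock S f a d := by
  intro x hx y hy z hz _ _ _ _ _ _
  by_contra hn
  have hne : f y ≠ f b := fun h => by
    have := hf hy hb h
    omega
  have e1 := h1 x hx y hy z hz
  have e2 := h2 x hx y hy z hz
  have e3 := h1 x hx y hy b hb
  have e4 := h2 x hx y hy b hb
  have e5 := h1 b hb y hy z hz
  have e6 := h2 b hb y hy z hz
  omega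

theorem diff_left (hf : Set.InjOn f S) (h1 : ConvexBlock S f a c) (h2 : ConvexBlock S f b d)
    (hc : c ∈ S) (hbc : b ≤ c) (hcd : c < d) : ConvexBlock S f a b := by
  intro x hx y hy z hz _ _ _ _ _ _
  by_contra hn
  have hne : f x ≠ f c := fun h => by
    have := hf hx hc h
    omega
  have hne : f z ≠ f c := fun h => by
    have := hf hz hc h
    omega
  have e1 := h1 x hx y hy z hz
  have e2 := h1 x hx c hc z hz
  have e3 := h2 c hc x hx y hy
  have e4 := h2 y hy z hz c hc
  omega

theorem diff_right (hf : Set.InjOn f S) (h1 : ConvexBlock S f a c) (h2 : ConvexBlock S f b d)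
    (ha : a ∈ S) (hab : a < b) (hbc : b ≤ c) : ConvexBlock S f c d := by
  intro x hx y hy z hz _ _ _ _ _ _
  by_contra hn
  have hne : f x ≠ f a := fun h => by
    have := hf hx ha h
    omega
  have hne : f z ≠ f a := fun h => by
    have := hf hz ha h
    omega
  have e1 := h2 x hx y hy z hz
  have e2 := h2 x hx a ha z hz
  have e3 := h1 a ha x hx y hy
  have e4 := h1 y hy z hz a ha
  omega

/-- Disjoint consecutive blocks are comparable as a whole. -/
theorem lt_of_lt (hf : Set.InjOn f S) (h1 : ConvexBlock S f a b) (h2 : ConvexBlock S f c d)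
    (hbc : b ≤ c ∨ d ≤ a) {x x' y y' : ℕ} (hx : x ∈ S) (hx' : x' ∈ S) (hy : y ∈ S)
    (hy' : y' ∈ S) (hxa : a ≤ x ∧ x < b) (hxa' : a ≤ x' ∧ x' < b) (hyc : c ≤ y ∧ y < d)
    (hyc' : c ≤ y' ∧ y' < d) (h : f x < f y) : f x' < f y' := by
  have hne : f x' ≠ f y' := fun h => by
    have := hf hx' hy' h
    omega
  have hne : f x ≠ f y' := fun h => by
    have := hf hx hy' h
    omega
  have e1 := h2 y' hy' x hx y hy
  have e2 := h1 x hx y' hy' x' hx'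
  omega

/-- Of three consecutive blocks with consecutive union, two neighbours have consecutive union. -/
theorem three_blocks (hf : Set.InjOn f S) (h1 : ConvexBlock S f a b) (h2 : ConvexBlock S f b c)
    (h3 : ConvexBlock S f c d) (h : ConvexBlock S f a d) (hab : a ≤ b) (hbc : b ≤ c)
    (hcd : c ≤ d) : ConvexBlock S f a c ∨ ConvexBlock S f b d := by
  by_contra! hn
  obtain ⟨n1, n2⟩ := hn
  unfold ConvexBlock at n1 n2
  push Not at n1 n2
  obtain ⟨x, hx, y, hy, z, hz, x1, x2, z1, z2, xy, yz, hy'⟩ := n1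
  obtain ⟨p, hp, q, hq, s, hs, p1, p2, s1, s2, pq, qs, hq'⟩ := n2
  have y0 := h x hx y hy z hz x1 (by omega) z1 (by omega) xy yz
  have q0 := h p hp q hq s hs (by omega) p2 (by omega) s2 pq qs
  have y1 := h1 x hx y hy z hz
  have y2 := h2 x hx y hy z hz
  have q1 := h2 p hp q hq s hs
  have q2 := h3 p hp q hq s hs
  have hyc : c ≤ y ∧ y < d := by omega
  have hqb : a ≤ q ∧ q < b := by omega
  rcases lt_or_ge x b with hxb | hxb
  · have hzb : b ≤ z := by omega
    rcases lt_or_ge p c with hpc | hpc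
    · have := h1.lt_of_lt hf h2 (by omega) hx hq hz hp (by omega) hqb (by omega) (by omega)
        (xy.trans yz)
      omega
    · have := h1.lt_of_lt hf h3 (by omega) hx hq hy hp (by omega) hqb hyc (by omega) xy
      omega
  · have hzb : z < b := by omega
    rcases lt_or_ge p c with hpc | hpc
    · have hsc : c ≤ s := by omega
      have := h1.lt_of_lt hf h3 (by omega) hq hz hs hy hqb (by omega) (by omega) hyc qs
      omega
    · have hsc : s < c := by omega
      have := h1.lt_of_lt hf h2 (by omega) hq hz hs hx hqb (by omega) (by omega) (by omega) qs
      omega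

end ConvexBlock

namespace Realizes

variable {V : Finset ℕ} {r : ℕ} {E : ℕ → ℕ → Prop} {f : ℕ → ℤ}

theorem injOn (h : Realizes V r E f) : Set.InjOn f (V.filter (· < r)) := by
  intro x hx y hy
  simp only [Finset.coe_filter, Set.mem_ofPred_eq] at hx hy
  exact h.inj x hx.1 y hy.1 hx.2 hy.2

theorem neg (h : Realizes V r E f) : Realizes V r E (fun x => - f x) where
  inj x hx y hy hxr hyr he := h.inj x hx y hy hxr hyr (by simpa using he)
  iff u hu v hv huv := by
    rw [h.iff u hu v hv huv]
    refine ⟨fun h => h.neg, fun h => ?_⟩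
    simpa using h.neg

/-- Up to reversal, the initial block lies below the final block at every cut. -/
theorem exists_cuts_up {l : ℕ} (h : Realizes V r E f) (hl : l ∈ V) (hr : r ∈ V) :
    ∃ g, Realizes V r E g ∧ ∀ u ∈ V, l < u → u < r → E l u → E u r → g l < g u := by
  by_cases hc : ∀ u ∈ V, l < u → u < r → E l u → E u r → f l < f u
  · exact ⟨f, h, hc⟩
  push Not at hc
  obtain ⟨w, hw, hlw, hwr, h1, h2, h3⟩ := hc
  refine ⟨_, h.neg, fun u hu hlu hur h4 h5 => ?_⟩
  rw [h.iff _ hl _ hw hlw] at h1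
  rw [h.iff _ hw _ hr hwr] at h2
  rw [h.iff _ hl _ hu hlu] at h4
  rw [h.iff _ hu _ hr hur] at h5
  have hlr : l < r := by omega
  have hwl : f w ≠ f l := fun e => by
    have := h.inj _ hw _ hl hwr hlr e
    omega
  have ml : l ∈ V.filter (· < r) := by simp [hl, hlr]
  have mw : w ∈ V.filter (· < r) := by simp [hw, hwr]
  have mu : u ∈ V.filter (· < r) := by simp [hu, hur]
  have : f u < f l := by
    rcases le_total w u with hwu | hwu
    · exact h2.lt_of_lt h.injOn h1 (by omega) mw mu ml ml (by omega) (by omega) (by omega)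
        (by omega) (by omega)
    · exact h5.lt_of_lt h.injOn h4 (by omega) mw mu ml ml (by omega) (by omega) (by omega)
        (by omega) (by omega)
  simpa using this

/-- Up to reversal, every block that can be merged with the side `(a, b)` descends at it. -/
theorem exists_descending_at {a b : ℕ} (h : Realizes V r E f) (ha : a ∈ V) (hb : b ∈ V)
    (hab : a < b) (hbr : b ≤ r) :
    ∃ g, Realizes V r E g ∧ (∀ v ∈ V, b < v → v ≤ r → E a v → E b v → g b < g a) ∧
      (∀ v ∈ V, v < a → E v a → E v b → g a < g v) := by
  have ma : a ∈ V.filter (· < r) := by simp [ha]; omega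
  have key : ∀ v ∈ V, b < v → v ≤ r → E a v → ∀ w ∈ V, w < a → E w b →
      (f a < f b ↔ f w < f a) := by
    intro v hv hbv hvr hE w hw hwa hE'
    have mb : b ∈ V.filter (· < r) := by simp [hb]; omega
    have mw : w ∈ V.filter (· < r) := by simp [hw]; omega
    rw [h.iff _ ha _ hv (by omega)] at hE
    rw [h.iff _ hw _ hb (by omega)] at hE'
    have n1 : f a ≠ f b := fun e => by
      have := h.injOn ma mb e
      omega
    have n2 : f a ≠ f w := fun e => by
      have := h.injOn ma mw e
      omega
    have n3 : f b ≠ f w := fun e => by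
      have := h.injOn mb mw e
      omega
    have e1 := hE a ma w mw b mb
    have e2 := hE b mb w mw a ma
    have e3 := hE' a ma b mb w mw
    have e4 := hE' w mw b mb a ma
    omega
  by_cases hc : (∀ v ∈ V, b < v → v ≤ r → E a v → E b v → f b < f a) ∧
      (∀ v ∈ V, v < a → E v a → E v b → f a < f v)
  · exact ⟨f, h, hc⟩
  refine ⟨_, h.neg, ?_⟩
  simp only [neg_lt_neg_iff]
  rw [not_and_or] at hc
  push Not at hc
  rcases hc with ⟨v, hv, hbv, hvr, h1, h2, h3⟩ | ⟨w, hw, hwa, h1, h2, h3⟩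
  · have hlt : f a < f b := lt_of_le_of_ne h3 fun e => by
      have := h.inj _ ha _ hb (by omega) (by omega) e
      omega
    exact ⟨fun _ _ _ _ _ _ => hlt,
      fun w hw hwa _ h4 => (key v hv hbv hvr h1 w hw hwa h4).1 hlt⟩
  · have hlt : f w < f a := lt_of_le_of_ne h3 fun e => by
      have := h.inj _ hw _ ha (by omega) (by omega) e
      omega
    refine ⟨fun v hv hbv hvr h4 _ => (key v hv hbv hvr h4 w hw hwa h2).2 hlt,
      fun v hv hva h4 h5 => ?_⟩
    have mv : v ∈ V.filter (· < r) := by simp [hv]; omega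
    have mw : w ∈ V.filter (· < r) := by simp [hw]; omega
    have n : f v ≠ f a := fun e => by
      have := h.injOn mv ma e
      omega
    rw [h.iff _ hw _ ha hwa] at h1
    rw [h.iff _ hv _ ha hva] at h4
    have e1 := h1 w mw a ma v mv
    have e2 := h4 w mw a ma v mv
    omega

end Realizes

theorem exists_lex_labelling (S : Finset ℕ) (g₁ g₂ : ℕ → ℤ) :
    ∃ h : ℕ → ℤ, ∀ x ∈ S, ∀ y ∈ S, h x < h y ↔ g₂ x < g₂ y ∨ (g₂ x = g₂ y ∧ g₁ x < g₁ y) := by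
  obtain ⟨B, hB⟩ : ∃ B : ℤ, ∀ x ∈ S, |g₁ x| ≤ B := by
    obtain ⟨B, hB⟩ := (S.image fun x => |g₁ x|).bddAbove
    exact ⟨B, fun x hx => hB (by simpa using ⟨x, hx, rfl⟩)⟩
  have key : ∀ x ∈ S, ∀ y ∈ S, g₂ x < g₂ y →
      g₂ x * (2 * B + 1) + g₁ x < g₂ y * (2 * B + 1) + g₁ y := by
    intro x hx y hy hlt
    have h1 := abs_le.1 (hB x hx)
    have h2 := abs_le.1 (hB y hy)
    have hB0 : 0 ≤ B := (abs_nonneg _).trans (hB x hx)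
    nlinarith
  refine ⟨fun x => g₂ x * (2 * B + 1) + g₁ x, fun x hx y hy => ?_⟩
  dsimp only
  rcases lt_trichotomy (g₂ x) (g₂ y) with h | h | h
  · simpa [h] using key x hx y hy h
  · simp [h]
  · have := key y hy x hx h
    constructor
    · intro; omega
    · rintro (_ | _) <;> omega

namespace FramedPolygon

variable {V : Finset ℕ} {l r : ℕ} {E : ℕ → ℕ → Prop}

/-- The part of the polygon cut off by an uncrossed edge. -/
theorem inner (h : FramedPolygon V l r E) {a b : ℕ} (ha : a ∈ V) (hb : b ∈ V) (hab : a < b)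
    (hE : E a b) (hs : ∀ p ∈ V, ∀ q ∈ V, E p q → ¬ Cross (p, q) (a, b)) :
    FramedPolygon (V.filter fun x => a ≤ x ∧ x ≤ b) a b E where
  left_mem := by simp [ha]; omega
  right_mem := by simp [hb]; omega
  lt := hab
  bounds x hx := by simp at hx; exact hx.2
  top := hE
  adj u hu v hv huv hw := by
    simp only [Finset.mem_filter] at hu hv hw
    refine h.adj u hu.1 v hv.1 huv fun w hwV => ?_
    by_cases hwab : a ≤ w ∧ w ≤ b
    · exact hw w ⟨hwV, hwab⟩
    · omega
  framed p hp q hq s hs t ht := by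
    simp only [Finset.mem_filter] at hp hq hs ht
    exact h.framed p hp.1 q hq.1 s hs.1 t ht.1
  noQuad p hp q hq s hs' t ht hpq hqs hst e1 e2 e3 e4 := by
    simp only [Finset.mem_filter] at hp hq hs' ht ⊢
    rcases h.noQuad p hp.1 q hq.1 s hs'.1 t ht.1 hpq hqs hst e1 e2 e3 e4 with
      h1 | h1 | ⟨x, hx, y, hy, hxy, hE', hc⟩
    · exact Or.inl h1
    · exact Or.inr (Or.inl h1)
    · have := hs x hx y hy hE'
      refine Or.inr (Or.inr ⟨x, ⟨hx, ?_⟩, y, ⟨hy, ?_⟩, hxy, hE', hc⟩) <;>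
        simp only [Cross] at this hc <;> omega

/-- The polygon left after cutting along an uncrossed edge. -/
theorem outer (h : FramedPolygon V l r E) {a b : ℕ} (ha : a ∈ V) (hb : b ∈ V) (hab : a < b)
    (hE : E a b) (hs : ∀ p ∈ V, ∀ q ∈ V, E p q → ¬ Cross (p, q) (a, b)) :
    FramedPolygon (V.filter fun x => x ≤ a ∨ b ≤ x) l r E where
  left_mem := by simp [h.left_mem, (h.bounds a ha).1]
  right_mem := by simp [h.right_mem, (h.bounds b hb).2]
  lt := h.lt
  bounds x hx := by simp at hx; exact h.bounds x hx.1
  top := h.top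
  adj u hu v hv huv hw := by
    simp only [Finset.mem_filter] at hu hv hw
    have h1 := hw a ⟨ha, by omega⟩
    have h2 := hw b ⟨hb, by omega⟩
    by_cases huv' : u = a ∧ v = b
    · rw [huv'.1, huv'.2]
      exact hE
    refine h.adj u hu.1 v hv.1 huv fun w hwV => ?_
    by_cases hwab : w ≤ a ∨ b ≤ w
    · exact hw w ⟨hwV, hwab⟩
    · omega
  framed p hp q hq s hs t ht := by
    simp only [Finset.mem_filter] at hp hq hs ht
    exact h.framed p hp.1 q hq.1 s hs.1 t ht.1
  noQuad p hp q hq s hs' t ht hpq hqs hst e1 e2 e3 e4 := by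
    simp only [Finset.mem_filter] at hp hq hs' ht ⊢
    rcases h.noQuad p hp.1 q hq.1 s hs'.1 t ht.1 hpq hqs hst e1 e2 e3 e4 with
      h1 | h1 | ⟨x, hx, y, hy, hxy, hE', hc⟩
    · exact Or.inl h1
    · exact Or.inr (Or.inl h1)
    · have := hs x hx y hy hE'
      refine Or.inr (Or.inr ⟨x, ⟨hx, ?_⟩, y, ⟨hy, ?_⟩, hxy, hE', hc⟩) <;>
        simp only [Cross] at this hc <;> omega

/-- Labellings of the two parts of a polygon cut along an uncrossed edge can be glued. -/
theorem glue (h : FramedPolygon V l r E) {a b : ℕ} (ha : a ∈ V) (hb : b ∈ V) (hab : a < b)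
    (hE : E a b) (hs : ∀ p ∈ V, ∀ q ∈ V, E p q → ¬ Cross (p, q) (a, b))
    (hin : ∃ f, Realizes (V.filter fun x => a ≤ x ∧ x ≤ b) b E f)
    (hout : ∃ f, Realizes (V.filter fun x => x ≤ a ∨ b ≤ x) r E f) :
    ∃ f, Realizes V r E f := by
  have hla := (h.bounds a ha).1
  have hbr := (h.bounds b hb).2
  obtain ⟨f₁', hf₁'⟩ := hin
  obtain ⟨f₂', hf₂'⟩ := hout
  obtain ⟨f₁, hf₁, up⟩ := hf₁'.exists_cuts_up (l := a) (by simp [ha]; omega) (by simp [hb]; omega)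
  obtain ⟨f₂, hf₂, dr, dl⟩ := hf₂'.exists_descending_at (a := a) (b := b) (by simp [ha])
    (by simp [hb]) hab hbr
  simp only [Finset.mem_filter] at up dr dl
  obtain ⟨f, hf⟩ := exists_lex_labelling V (fun x => if a ≤ x ∧ x < b then f₁ x else 0)
    (fun x => if a ≤ x ∧ x < b then f₂ a else f₂ x)
  have lt_in : ∀ x ∈ V, ∀ y ∈ V, a ≤ x ∧ x < b → a ≤ y ∧ y < b → (f x < f y ↔ f₁ x < f₁ y) := by
    intro x hx y hy hxa hya
    simp [hf x hx y hy, hxa, hya]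
  have lt_out : ∀ x ∈ V, ∀ y ∈ V, ¬ (a ≤ x ∧ x < b) → ¬ (a ≤ y ∧ y < b) →
      (f x < f y ↔ f₂ x < f₂ y) := by
    intro x hx y hy hxa hya
    simp only [hf x hx y hy, if_neg hxa, if_neg hya]
    omega
  have ne₂ : ∀ x ∈ V, x < r → ¬ (a ≤ x ∧ x < b) → f₂ x ≠ f₂ a := fun x hx hxr hxa e => by
    have := hf₂.inj x (by simp [hx]; omega) a (by simp [ha]) hxr (by omega) e
    omega
  have lt_in_out : ∀ x ∈ V, ∀ y ∈ V, a ≤ x ∧ x < b → y < r → ¬ (a ≤ y ∧ y < b) →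
      (f x < f y ↔ f₂ a < f₂ y) := by
    intro x hx y hy hxa hyr hya
    have := ne₂ y hy hyr hya
    simp only [hf x hx y hy, if_pos hxa, if_neg hya]
    omega
  have lt_out_in : ∀ x ∈ V, ∀ y ∈ V, a ≤ x ∧ x < b → y < r → ¬ (a ≤ y ∧ y < b) →
      (f y < f x ↔ f₂ y < f₂ a) := by
    intro x hx y hy hxa hyr hya
    have := ne₂ y hy hyr hya
    simp only [hf y hy x hx, if_pos hxa, if_neg hya]
    omega
  have inj : ∀ x ∈ V, ∀ y ∈ V, x < r → y < r → f x = f y → x = y := by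
    intro x hx y hy hxr hyr e
    by_cases hxa : a ≤ x ∧ x < b <;> by_cases hya : a ≤ y ∧ y < b
    · have h1 := lt_in x hx y hy hxa hya
      have h2 := lt_in y hy x hx hya hxa
      exact hf₁.inj x (by simp [hx]; omega) y (by simp [hy]; omega) hxa.2 hya.2 (by omega)
    · have h1 := lt_in_out x hx y hy hxa hyr hya
      have h2 := lt_out_in x hx y hy hxa hyr hya
      have := ne₂ y hy hyr hya
      omega
    · have h1 := lt_in_out y hy x hx hya hxr hxa
      have h2 := lt_out_in y hy x hx hya hxr hxa
      have := ne₂ x hx hxr hxa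
      omega
    · have h1 := lt_out x hx y hy hxa hya
      have h2 := lt_out y hy x hx hya hxa
      exact hf₂.inj x (by simp [hx]; omega) y (by simp [hy]; omega) hxr hyr (by omega)
  have injOn : Set.InjOn f (V.filter (· < r)) := by
    intro x hx y hy
    simp only [Finset.coe_filter, Set.mem_ofPred_eq] at hx hy
    exact inj x hx.1 y hy.1 hx.2 hy.2
  have iff_in : ∀ u ∈ V, ∀ v ∈ V, u < v → a ≤ u → v ≤ b →
      (E u v ↔ ConvexBlock (V.filter (· < r)) f u v) := by
    intro u hu v hv huv hau hvb
    rw [hf₁.iff u (by simp [hu]; omega) v (by simp [hv]; omega) huv]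
    simp only [ConvexBlock, Finset.mem_filter]
    constructor
    · intro H x hx y hy z hz x1 x2 z1 z2 xy yz
      have hya : a ≤ y ∧ y < b := by
        by_contra hya
        rw [lt_in_out x hx.1 y hy.1 (by omega) hy.2 hya] at xy
        rw [lt_out_in z hz.1 y hy.1 (by omega) hy.2 hya] at yz
        omega
      rw [lt_in x hx.1 y hy.1 (by omega) hya] at xy
      rw [lt_in y hy.1 z hz.1 hya (by omega)] at yz
      exact H x ⟨⟨hx.1, by omega⟩, by omega⟩ y ⟨⟨hy.1, by omega⟩, by omega⟩
        z ⟨⟨hz.1, by omega⟩, by omega⟩ x1 x2 z1 z2 xy yz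
    · intro H x hx y hy z hz x1 x2 z1 z2 xy yz
      rw [← lt_in x hx.1.1 y hy.1.1 (by omega) (by omega)] at xy
      rw [← lt_in y hy.1.1 z hz.1.1 (by omega) (by omega)] at yz
      exact H x ⟨hx.1.1, by omega⟩ y ⟨hy.1.1, by omega⟩ z ⟨hz.1.1, by omega⟩ x1 x2 z1 z2 xy yz
  have iff_out : ∀ u ∈ V, ∀ v ∈ V, u < v → (u ≤ a ∨ b ≤ u) → (v ≤ a ∨ b ≤ v) →
      (E u v ↔ ConvexBlock (V.filter (· < r)) f u v) := by
    intro u hu v hv huv hua hva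
    rw [hf₂.iff u (by simp [hu]; omega) v (by simp [hv]; omega) huv]
    simp only [ConvexBlock, Finset.mem_filter]
    have lt_of : ∀ x ∈ V, ∀ y ∈ V, x < r → y < r → (x ≤ a ∨ b ≤ x) → (y ≤ a ∨ b ≤ y) →
        (f₂ x < f₂ y → f x < f y) := by
      intro x hx y hy hxr hyr hx' hy' hlt
      by_cases hxa : a ≤ x ∧ x < b <;> by_cases hya : a ≤ y ∧ y < b
      · have : x = y := by omega
        subst this
        omega
      · rw [lt_in_out x hx y hy hxa hyr hya]
        rwa [show x = a by omega] at hlt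
      · rw [lt_out_in y hy x hx hya hxr hxa]
        rwa [show y = a by omega] at hlt
      · exact (lt_out x hx y hy hxa hya).2 hlt
    have proj : ∀ x ∈ V, x < r → ∃ x' ∈ V, x' < r ∧ (x' ≤ a ∨ b ≤ x') ∧
        (u ≤ x' ↔ u ≤ x) ∧ (x' < v ↔ x < v) ∧
        f₂ x' = if a ≤ x ∧ x < b then f₂ a else f₂ x := by
      intro x hx hxr
      by_cases hxa : a ≤ x ∧ x < b
      · exact ⟨a, ha, by omega, by omega, by omega, by omega, by simp [hxa]⟩
      · exact ⟨x, hx, hxr, by omega, Iff.rfl, Iff.rfl, by simp [hxa]⟩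
    constructor
    · intro H x hx y hy z hz x1 x2 z1 z2 xy yz
      obtain ⟨x', hx', xr, xo, xu, xv, ex⟩ := proj x hx.1 hx.2
      obtain ⟨y', hy', yr, yo, yu, yv, ey⟩ := proj y hy.1 hy.2
      obtain ⟨z', hz', zr, zo, zu, zv, ez⟩ := proj z hz.1 hz.2
      rw [hf x hx.1 y hy.1] at xy
      rw [hf y hy.1 z hz.1] at yz
      simp only [← ex, ← ey, ← ez] at xy yz
      rw [← yu, ← yv]
      by_cases e1 : f₂ x' = f₂ y'
      · have := hf₂.inj x' (by simp [hx', xo]) y' (by simp [hy', yo]) xr yr e1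
        omega
      by_cases e2 : f₂ y' = f₂ z'
      · have := hf₂.inj y' (by simp [hy', yo]) z' (by simp [hz', zo]) yr zr e2
        omega
      exact H x' ⟨⟨hx', xo⟩, xr⟩ y' ⟨⟨hy', yo⟩, yr⟩ z' ⟨⟨hz', zo⟩, zr⟩ (xu.2 x1) (xv.2 x2)
        (zu.2 z1) (zv.2 z2) (by omega) (by omega)
    · intro H x hx y hy z hz x1 x2 z1 z2 xy yz
      exact H x ⟨hx.1.1, hx.2⟩ y ⟨hy.1.1, hy.2⟩ z ⟨hz.1.1, hz.2⟩ x1 x2 z1 z2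
        (lt_of x hx.1.1 y hy.1.1 hx.2 hy.2 hx.1.2 hy.1.2 xy)
        (lt_of y hy.1.1 z hz.1.1 hy.2 hz.2 hy.1.2 hz.1.2 yz)
  have conv_ab := (iff_in a ha b hb hab le_rfl le_rfl).1 hE
  refine ⟨f, inj, fun u hu v hv huv => ?_⟩
  have hlu := (h.bounds u hu).1
  have hvr := (h.bounds v hv).2
  by_cases c1 : a ≤ u ∧ v ≤ b
  · exact iff_in u hu v hv huv c1.1 c1.2
  by_cases c2 : (u ≤ a ∨ b ≤ u) ∧ (v ≤ a ∨ b ≤ v)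
  · exact iff_out u hu v hv huv c2.1 c2.2
  have hcr : Cross (u, v) (a, b) := by
    simp only [Cross]
    omega
  refine ⟨fun hE' => absurd hcr (hs u hu v hv hE'), fun hC => ?_⟩
  exfalso
  have ma : a ∈ V.filter (· < r) := by simp [ha]; omega
  have mu : u ∈ V.filter (· < r) := by simp [hu]; omega
  simp only [Cross] at hcr
  rcases hcr with ⟨hua, hav, hvb⟩ | ⟨hau, hub, hbv⟩
  · have mv : v ∈ V.filter (· < r) := by simp [hv]; omega
    have i1 := (iff_out u hu a ha hua (by omega) (by omega)).2
      (hC.diff_left injOn conv_ab mv hav.le hvb)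
    have i2 := (iff_in a ha v hv hav (by omega) (by omega)).2
      (hC.inter conv_ab hua.le hvb.le)
    have i3 := (iff_in v hv b hb hvb (by omega) (by omega)).2
      (hC.diff_right injOn conv_ab mu hua hav.le)
    have i4 := (iff_out u hu b hb (by omega) (by omega) (by omega)).2
      (hC.union injOn conv_ab ma hua.le hav hvb.le)
    have j1 := up v ⟨hv, by omega⟩ hav hvb i2 i3
    have j2 := dl u ⟨hu, by omega⟩ hua i1 i4
    rw [← lt_in a ha v hv (by omega) (by omega)] at j1
    rw [← lt_in_out v hv u hu (by omega) (by omega) (by omega)] at j2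
    have := hC a ma v mv u mu
    omega
  · have mb : b ∈ V.filter (· < r) := by simp [hb]; omega
    have i1 := (iff_in a ha u hu hau (by omega) (by omega)).2
      (conv_ab.diff_left injOn hC mb hub.le hbv)
    have i2 := (iff_in u hu b hb hub (by omega) (by omega)).2
      (conv_ab.inter hC hau.le hbv.le)
    have i3 := (iff_out b hb v hv hbv (by omega) (by omega)).2
      (conv_ab.diff_right injOn hC ma hau hub.le)
    have i4 := (iff_out a ha v hv (by omega) (by omega) (by omega)).2
      (conv_ab.union injOn hC mu hau.le hub hbv.le)
    have j1 := up u ⟨hu, by omega⟩ hau hub i1 i2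
    have j2 := dr v ⟨hv, by omega⟩ hbv hvr i4 i3
    rw [← lt_in a ha u hu (by omega) (by omega)] at j1
    rw [← lt_out_in a ha b hb (by omega) (by omega) (by omega)] at j2
    have := hC b mb a ma u mu
    omega

/-- Without uncrossed proper diagonals, any proper diagonal yields a cut vertex, joined to both
extreme vertices. -/
theorem exists_cut (h : FramedPolygon V l r E)
    (hs : ∀ a ∈ V, ∀ b ∈ V, E a b → ¬ (a = l ∧ b = r) → (∃ w ∈ V, a < w ∧ w < b) →
      ∃ p ∈ V, ∃ q ∈ V, E p q ∧ Cross (p, q) (a, b))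
    (hn : ∃ a ∈ V, ∃ b ∈ V, E a b ∧ ¬ (a = l ∧ b = r) ∧ ∃ w ∈ V, a < w ∧ w < b) :
    ∃ c ∈ V, l < c ∧ c < r ∧ E l c ∧ E c r := by
  classical
  obtain ⟨a₀, ha₀, b₀, hb₀, h₀⟩ := hn
  obtain ⟨⟨a, b⟩, hm, hmax⟩ := Finset.exists_max_image
    ((V ×ˢ V).filter fun p => E p.1 p.2 ∧ ¬ (p.1 = l ∧ p.2 = r) ∧ ∃ w ∈ V, p.1 < w ∧ w < p.2)
    (fun p => p.2 - p.1) ⟨(a₀, b₀), by simpa [ha₀, hb₀] using h₀⟩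
  simp only [Finset.mem_filter, Finset.mem_product] at hm hmax
  obtain ⟨⟨ha, hb⟩, hE, hne, w, hw, haw, hwb⟩ := hm
  obtain ⟨p, hp, q, hq, hE', hc⟩ := hs a ha b hb hE hne ⟨w, hw, haw, hwb⟩
  have hpl := (h.bounds p hp).1
  have hqr := (h.bounds q hq).2
  simp only [Cross] at hc
  rcases hc with ⟨h1, h2, h3⟩ | ⟨h1, h2, h3⟩
  · obtain ⟨e1, _, _, e4⟩ := h.framed p hp a ha q hq b hb h1 h2 h3 hE' hE
    by_cases hlr : p = l ∧ b = r
    · obtain ⟨rfl, rfl⟩ := hlr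
      exact ⟨a, ha, h1, by omega, e1, hE⟩
    · have := hmax (p, b) ⟨⟨hp, hb⟩, e4, hlr, w, hw, by dsimp only; omega, hwb⟩
      dsimp only at this
      omega
  · obtain ⟨_, _, e3, e4⟩ := h.framed a ha p hp b hb q hq h1 h2 h3 hE hE'
    by_cases hlr : a = l ∧ q = r
    · obtain ⟨rfl, rfl⟩ := hlr
      exact ⟨b, hb, by omega, h3, hE, e3⟩
    · have := hmax (a, q) ⟨⟨ha, hq⟩, e4, hlr, w, hw, haw, by dsimp only; omega⟩
      dsimp only at this
      omega

/-- Without uncrossed proper diagonals, a cut vertex forces all diagonals to be present. -/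
theorem complete_of_cut (h : FramedPolygon V l r E)
    (hs : ∀ a ∈ V, ∀ b ∈ V, E a b → ¬ (a = l ∧ b = r) → (∃ w ∈ V, a < w ∧ w < b) →
      ∃ p ∈ V, ∃ q ∈ V, E p q ∧ Cross (p, q) (a, b))
    (hcut : ∃ c ∈ V, l < c ∧ c < r ∧ E l c ∧ E c r) :
    ∀ u ∈ V, ∀ v ∈ V, u < v → E u v := by
  classical
  have hl := h.left_mem
  have hr := h.right_mem
  have edge : ∀ u ∈ V, ∀ v ∈ V, u < v → (u = r ∨ E u r) → (v = l ∨ E l v) → E u v := by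
    intro u hu v hv huv h1 h2
    have bu := h.bounds u hu
    have bv := h.bounds v hv
    have h1' : E u r := h1.resolve_left (by omega)
    have h2' : E l v := h2.resolve_left (by omega)
    rcases bu.1.eq_or_lt with rfl | hlu
    · exact h2'
    rcases bv.2.eq_or_lt with rfl | hvr
    · exact h1'
    exact (h.framed l hl u hu v hv r hr hlu huv hvr h2' h1').2.1
  suffices H : ∀ x ∈ V, (x = l ∨ E l x) ∧ (x = r ∨ E x r) from
    fun u hu v hv huv => edge u hu v hv huv (H u hu).2 (H v hv).1
  intro x hx
  by_contra hxK
  obtain ⟨s, hsm, hsmax⟩ := Finset.exists_max_image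
    (V.filter fun w => ((w = l ∨ E l w) ∧ (w = r ∨ E w r)) ∧ w ≤ x) id
    ⟨l, by simp [hl, h.top, (h.bounds x hx).1]⟩
  obtain ⟨t, htm, htmin⟩ := Finset.exists_min_image
    (V.filter fun w => ((w = l ∨ E l w) ∧ (w = r ∨ E w r)) ∧ x ≤ w) id
    ⟨r, by simp [hr, h.top, (h.bounds x hx).2]⟩
  simp only [Finset.mem_filter, id] at hsm hsmax htm htmin
  obtain ⟨hsV, ⟨hs1, hs2⟩, hsx⟩ := hsm
  obtain ⟨htV, ⟨ht1, ht2⟩, hxt⟩ := htm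
  have hsx' : s < x := lt_of_le_of_ne hsx fun e => hxK (e ▸ ⟨hs1, hs2⟩)
  have hxt' : x < t := lt_of_le_of_ne hxt fun e => hxK (e ▸ ⟨ht1, ht2⟩)
  have hnone : ∀ w ∈ V, s < w → w < t → (w = l ∨ E l w) → (w = r ∨ E w r) → False := by
    intro w hw hsw hwt h1 h2
    rcases le_total w x with hwx | hwx
    · have := hsmax w ⟨hw, ⟨h1, h2⟩, hwx⟩
      omega
    · have := htmin w ⟨hw, ⟨h1, h2⟩, hwx⟩
      omega
  have hst : ¬ (s = l ∧ t = r) := by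
    rintro ⟨rfl, rfl⟩
    obtain ⟨c, hc, c1, c2, c3, c4⟩ := hcut
    exact hnone c hc c1 c2 (Or.inr c3) (Or.inr c4)
  have bs := h.bounds s hsV
  have bt := h.bounds t htV
  obtain ⟨p, hp, q, hq, hE, hc⟩ := hs s hsV t htV
    (edge s hsV t htV (by omega) hs2 ht1) hst ⟨x, hx, hsx', hxt'⟩
  have bp := h.bounds p hp
  have bq := h.bounds q hq
  simp only [Cross] at hc
  rcases hc with ⟨h1, h2, h3⟩ | ⟨h1, h2, h3⟩
  · have els : E l s := hs1.resolve_left (by omega)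
    have esr : E s r := hs2.resolve_left (by omega)
    refine hnone q hq h2 h3 (Or.inr ?_) (Or.inr ?_)
    · rcases bp.1.eq_or_lt with rfl | hlp
      · exact hE
      · exact (h.framed l hl p hp s hsV q hq hlp h1 h2 els hE).2.2.2
    · exact (h.framed p hp s hsV q hq r hr h1 h2 (by omega) hE esr).2.2.1
  · have elt : E l t := ht1.resolve_left (by omega)
    have etr : E t r := ht2.resolve_left (by omega)
    refine hnone p hp h1 h2 (Or.inr ?_) (Or.inr ?_)
    · exact (h.framed l hl p hp t htV q hq (by omega) h2 h3 elt hE).1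
    · rcases bq.2.eq_or_lt with rfl | hqr
      · exact hE
      · exact (h.framed p hp t htV q hq r hr h2 h3 hqr hE etr).2.2.2

/-- A polygon without proper diagonals is not a quadrilateral. -/
theorem exists_fifth_vertex (h : FramedPolygon V l r E)
    (ht : ∀ u ∈ V, ∀ v ∈ V, E u v → ¬ (u = l ∧ v = r) → ∀ w ∈ V, w ≤ u ∨ v ≤ w)
    {a b c d : ℕ} (ha : a ∈ V) (hb : b ∈ V) (hc : c ∈ V) (hd : d ∈ V) (hab : a < b)
    (hbc : b < c) (hcd : c < d) : ∃ x ∈ V, x ≠ a ∧ x ≠ b ∧ x ≠ c ∧ x ≠ d := by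
  by_contra! hn
  have hV : ∀ x ∈ V, x = a ∨ x = b ∨ x = c ∨ x = d := fun x hx => by
    have := hn x hx
    tauto
  have ba := h.bounds a ha
  have bd := h.bounds d hd
  have hl : l = a := by
    have := hV l h.left_mem
    omega
  have hr : r = d := by
    have := hV r h.right_mem
    omega
  subst hl hr
  have adj : ∀ u ∈ V, ∀ v ∈ V, u < v → (l ≤ u → u < b → v ≤ b) → (b ≤ u → u < c → v ≤ c) →
      E u v := by
    intro u hu v hv huv h1 h2
    refine h.adj u hu v hv huv fun w hw => ?_
    have := hV w hw
    have := hV u hu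
    have := hV v hv
    omega
  rcases h.noQuad l ha b hb c hc r hd hab hbc hcd (adj _ ha _ hb hab (by omega) (by omega))
    (adj _ hb _ hc hbc (by omega) (by omega)) (adj _ hc _ hd hcd (by omega) (by omega)) h.top with
    e | e | ⟨p, hp, q, hq, hpq, e, hcr⟩
  · have := ht _ ha _ hc e (by omega) b hb
    omega
  · have := ht _ hb _ hd e (by omega) c hc
    omega
  · simp only [Cross] at hcr
    have bp := hV p hp
    have bq := hV q hq
    have t1 := ht p hp q hq e
    by_cases hne : p = l ∧ q = r
    · omega
    · have t2 := t1 hne b hb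
      have t3 := t1 hne c hc
      omega

end FramedPolygon

/-- A sequence whose initial segments of length between `4` and `B` have the patterns of simple
permutations. -/
def simpleSeq (B : ℕ) (i : ℕ) : ℤ :=
  if i = 0 then B else if i = 1 then 3 * B else if i = 2 then 0 else if i = 3 then 2 * B
  else if i % 2 = 0 then i else 2 * B + i

theorem simpleSeq_injOn (B : ℕ) : Set.InjOn (simpleSeq B) (Finset.range B) := by
  intro x hx y hy
  simp only [Finset.coe_range, Set.mem_Iio] at hx hy
  unfold simpleSeq
  split_ifs <;> omega

theorem simpleSeq_not_convexBlock {B k : ℕ} (hk : 4 ≤ k) (hB : k ≤ B) :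
    ∀ i j, i + 2 ≤ j → j ≤ k → ¬ (i = 0 ∧ j = k) →
      ¬ ConvexBlock (Finset.range k) (simpleSeq B) i j := by
  have s0 : simpleSeq B 0 = B := rfl
  have s1 : simpleSeq B 1 = 3 * B := rfl
  have s2 : simpleSeq B 2 = 0 := rfl
  have s3 : simpleSeq B 3 = 2 * B := rfl
  induction k, hk using Nat.le_induction with
  | base =>
    intro i j hij hj hne H
    have e1 := H 0 (by simp) 3 (by simp) 1 (by simp)
    have e2 := H 2 (by simp) 0 (by simp) 1 (by simp)
    have e3 := H 2 (by simp) 0 (by simp) 3 (by simp)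
    rw [s0, s1, s3] at e1
    rw [s0, s1, s2] at e2
    rw [s0, s2, s3] at e3
    omega
  | succ k hk ih =>
    intro i j hij hj hne H
    have hrestrict : ConvexBlock (Finset.range k) (simpleSeq B) i (min j k) := by
      intro x hx y hy z hz x1 x2 z1 z2 xy yz
      simp only [Finset.mem_range] at hx hy hz
      have := H x (by simp; omega) y (by simp; omega) z (by simp; omega) x1 (by omega) z1
        (by omega) xy yz
      omega
    have sk : simpleSeq B k = if k % 2 = 0 then (k : ℤ) else 2 * B + k := by
      simp only [simpleSeq]
      grind
    by_cases hi : i + 2 ≤ min j k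
    · by_cases hall : i = 0 ∧ min j k = k
      · have := H 2 (by simp; omega) k (by simp) 1 (by simp; omega) (by omega) (by omega)
          (by omega) (by omega) (by grind) (by grind)
        omega
      · exact ih (by omega) i (min j k) hi (by omega) hall hrestrict
    · have sk' : simpleSeq B (k - 1) = if k = 4 then 2 * (B : ℤ) else
          if k % 2 = 0 then 2 * B + (k - 1) else (k - 1 : ℤ) := by
        simp only [simpleSeq]
        grind
      have hik : i = k - 1 := by omega
      have e1 := H k (by simp) 0 (by simp) (k - 1) (by simp) (by omega) (by omega)
        (by omega) (by omega)
      have e2 := H (k - 1) (by simp) 0 (by simp) k (by simp) (by omega) (by omega)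
        (by omega) (by omega)
      grind

theorem exists_rank (V : Finset ℕ) :
    ∃ idx : ℕ → ℕ, (∀ x ∈ V, ∀ y ∈ V, idx x < idx y ↔ x < y) ∧ (∀ x ∈ V, idx x < V.card) ∧
      ∀ i < V.card, ∃ x ∈ V, idx x = i := by
  let e := V.orderIsoOfFin rfl
  refine ⟨fun x => if hx : x ∈ V then (e.symm ⟨x, hx⟩).val else 0, ?_, ?_, ?_⟩
  · intro x hx y hy
    simp [hx, hy]
  · intro x hx
    simp [hx]
  · intro i hi
    exact ⟨e ⟨i, hi⟩, (e ⟨i, hi⟩).2, by simp⟩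

namespace FramedPolygon

variable {V : Finset ℕ} {l r : ℕ} {E : ℕ → ℕ → Prop}

theorem exists_realizes_of_prime (h : FramedPolygon V l r E) (hcard : 5 ≤ V.card)
    (ht : ∀ u ∈ V, ∀ v ∈ V, E u v → ¬ (u = l ∧ v = r) → ∀ w ∈ V, w ≤ u ∨ v ≤ w) :
    ∃ f, Realizes V r E f := by
  obtain ⟨idx, mono, lt_card, surj⟩ := exists_rank V
  have hidx_l : idx l = 0 := by
    obtain ⟨x, hx, hx0⟩ := surj 0 (by omega)
    have := mono x hx l h.left_mem
    have := h.bounds x hx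
    have := mono l h.left_mem x hx
    omega
  have hidx_r : idx r = V.card - 1 := by
    obtain ⟨x, hx, hxk⟩ := surj (V.card - 1) (by omega)
    have := mono r h.right_mem x hx
    have := h.bounds x hx
    have := lt_card r h.right_mem
    omega
  refine ⟨fun x => simpleSeq V.card (idx x), ?_, ?_⟩
  · intro x hx y hy _ _ e
    have := simpleSeq_injOn V.card (by simpa using lt_card x hx) (by simpa using lt_card y hy) e
    have := mono x hx y hy
    have := mono y hy x hx
    omega
  · intro u hu v hv huv
    have bu := h.bounds u hu
    have bv := h.bounds v hv
    constructor
    · intro hE x hx y hy z hz x1 x2 z1 z2 xy yz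
      simp only [Finset.mem_filter] at hx hy hz
      by_cases hlr : u = l ∧ v = r
      · have := h.bounds y hy.1
        omega
      · have h1 := ht u hu v hv hE hlr x hx.1
        have h2 := ht u hu v hv hE hlr z hz.1
        have : x = z := by omega
        subst this
        dsimp only at xy yz
        omega
    · intro H
      by_contra hE
      have hw : ∃ w ∈ V, u < w ∧ w < v := by
        by_contra! hw
        refine hE (h.adj u hu v hv huv fun w hwV => ?_)
        have := hw w hwV
        omega
      obtain ⟨w, hw, huw, hwv⟩ := hw
      have hlr : ¬ (u = l ∧ v = r) := by
        rintro ⟨rfl, rfl⟩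
        exact hE h.top
      have m1 := (mono u hu w hw).2 huw
      have m2 := (mono w hw v hv).2 hwv
      have m3 := lt_card v hv
      have m4 := mono l h.left_mem u hu
      have m5 := mono v hv r h.right_mem
      refine simpleSeq_not_convexBlock (B := V.card) (k := V.card - 1) (by omega) (by omega)
        (idx u) (idx v) (by omega) (by omega) (by omega) ?_
      intro x hx y hy z hz x1 x2 z1 z2 xy yz
      simp only [Finset.mem_range] at hx hy hz
      obtain ⟨x, hxV, rfl⟩ := surj x (by omega)
      obtain ⟨y, hyV, rfl⟩ := surj y (by omega)
      obtain ⟨z, hzV, rfl⟩ := surj z (by omega)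
      rw [← hidx_r, mono _ ‹_› _ h.right_mem] at hx hy hz
      rw [mono _ ‹_› _ hv] at x2 z2
      rw [← not_lt, mono _ ‹_› _ hu, not_lt] at x1 z1
      have := H x (by simp [hxV, hx]) y (by simp [hyV, hy]) z (by simp [hzV, hz]) x1 x2 z1 z2 xy yz
      rw [mono y hyV v hv, ← not_lt, mono y hyV u hu, not_lt]
      exact this

/-- Every diagonally framed polygon without quadrilateral faces is realized by a labelling. -/
theorem exists_realizes (h : FramedPolygon V l r E) : ∃ f, Realizes V r E f := by
  induction hk : V.card using Nat.strong_induction_on generalizing V l r with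
  | _ k ih =>
  subst hk
  by_cases hall : ∀ u ∈ V, ∀ v ∈ V, u < v → E u v
  · refine ⟨fun x => x, by simp, fun u hu v hv huv => ?_⟩
    simp only [hall u hu v hv huv, true_iff]
    intro x _ y _ z _ _ _ _ _ xy yz
    dsimp only at xy yz
    omega
  by_cases hs : ∀ a ∈ V, ∀ b ∈ V, E a b → ¬ (a = l ∧ b = r) → (∃ w ∈ V, a < w ∧ w < b) →
      ∃ p ∈ V, ∃ q ∈ V, E p q ∧ Cross (p, q) (a, b)
  · have ht : ∀ u ∈ V, ∀ v ∈ V, E u v → ¬ (u = l ∧ v = r) → ∀ w ∈ V, w ≤ u ∨ v ≤ w := by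
      intro u hu v hv hE hne w hw
      by_contra hlt
      exact hall (h.complete_of_cut hs
        (h.exists_cut hs ⟨u, hu, v, hv, hE, hne, w, hw, by omega, by omega⟩))
    push Not at hall
    obtain ⟨u, hu, v, hv, huv, hE⟩ := hall
    have hw : ∃ w ∈ V, u < w ∧ w < v := by
      by_contra! hw
      refine hE (h.adj u hu v hv huv fun w hwV => ?_)
      have := hw w hwV
      omega
    obtain ⟨w, hw, huw, hwv⟩ := hw
    have hlr : ¬ (u = l ∧ v = r) := by
      rintro ⟨rfl, rfl⟩
      exact hE h.top
    have bu := h.bounds u hu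
    have bv := h.bounds v hv
    have hfour : ∃ a ∈ V, ∃ b ∈ V, ∃ c ∈ V, ∃ d ∈ V, a < b ∧ b < c ∧ c < d := by
      by_cases hvr : v = r
      · exact ⟨l, h.left_mem, u, hu, w, hw, v, hv, by omega, huw, hwv⟩
      · exact ⟨u, hu, w, hw, v, hv, r, h.right_mem, huw, hwv, by omega⟩
    obtain ⟨a, ha, b, hb, c, hc, d, hd, hab, hbc, hcd⟩ := hfour
    obtain ⟨x, hx, xa, xb, xc, xd⟩ := h.exists_fifth_vertex ht ha hb hc hd hab hbc hcd
    refine h.exists_realizes_of_prime ?_ ht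
    have hsub : ({x, a, b, c, d} : Finset ℕ) ⊆ V := by
      simp [Finset.insert_subset_iff, *]
    have hcard : ({x, a, b, c, d} : Finset ℕ).card = 5 := by
      rw [Finset.card_insert_of_notMem (by simp [*]), Finset.card_insert_of_notMem (by simp; omega),
        Finset.card_insert_of_notMem (by simp; omega), Finset.card_pair (by omega)]
    exact hcard ▸ Finset.card_le_card hsub
  · push Not at hs
    obtain ⟨a, ha, b, hb, hE, hne, ⟨w, hw, haw, hwb⟩, hs⟩ := hs
    have hab : a < b := haw.trans hwb
    have bl := h.bounds a ha
    have br := h.bounds b hb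
    refine h.glue ha hb hab hE hs (ih _ ?_ (h.inner ha hb hab hE hs) rfl)
      (ih _ ?_ (h.outer ha hb hab hE hs) rfl)
    · refine Finset.card_lt_card (Finset.filter_ssubset.2 ?_)
      by_cases hal : a = l
      · exact ⟨r, h.right_mem, by omega⟩
      · exact ⟨l, h.left_mem, by omega⟩
    · exact Finset.card_lt_card (Finset.filter_ssubset.2 ⟨w, hw, by omega⟩)

end FramedPolygon

/-- The intervals of a permutation in terms of any labelling ordered like its inverse. -/
theorem isInterval_ivl_iff {n : ℕ} {π : Equiv.Perm (Fin n)} {f : ℕ → ℤ}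
    (hf : ∀ x y : Fin n, f (x + 1) < f (y + 1) ↔ π.symm x < π.symm y) (a b : ℕ) :
    IsInterval π (ivl n a b) ↔ ConvexBlock (Finset.Ico 1 (n + 1)) f a (b + 1) := by
  constructor
  · rintro ⟨-, H⟩ x hx y hy z hz x1 x2 z1 z2 xy yz
    simp only [Finset.mem_Ico] at hx hy hz
    obtain ⟨x, rfl⟩ := Nat.exists_eq_add_of_le' hx.1
    obtain ⟨y, rfl⟩ := Nat.exists_eq_add_of_le' hy.1
    obtain ⟨z, rfl⟩ := Nat.exists_eq_add_of_le' hz.1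
    have h1 := (hf ⟨x, by omega⟩ ⟨y, by omega⟩).1 xy
    have h2 := (hf ⟨y, by omega⟩ ⟨z, by omega⟩).1 yz
    have := H (x := π.symm ⟨x, by omega⟩) (z := π.symm ⟨z, by omega⟩)
      (Finset.mem_image_of_mem _ (by simp [ivl]; omega))
      (Finset.mem_image_of_mem _ (by simp [ivl]; omega)) h1.le h2.le
    simp [ivl] at this
    omega
  · intro H
    refine ⟨?_, ?_⟩
    · intro x y z hx hz hxy hyz
      simp only [ivl, Finset.mem_filter, Finset.mem_univ, true_and, Fin.le_def] at *
      omega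
    · intro x y z hx hz hxy hyz
      simp only [Finset.mem_image] at hx hz ⊢
      obtain ⟨x, hx, rfl⟩ := hx
      obtain ⟨z, hz, rfl⟩ := hz
      refine ⟨π y, ?_, by simp⟩
      rcases hxy.eq_or_lt with rfl | hxy
      · simpa using hx
      rcases hyz.eq_or_lt with rfl | hyz
      · simpa using hz
      have h1 := (hf x (π y)).2 (by simpa using hxy)
      have h2 := (hf (π y) z).2 (by simpa using hyz)
      simp only [ivl, Finset.mem_filter, Finset.mem_univ, true_and] at hx hz ⊢
      have := H _ (by simp) _ (by simp) _ (by simp) hx.1 (by omega) hz.1 (by omega) h1 h2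
      omega

theorem exists_labelling {n : ℕ} (π : Equiv.Perm (Fin n)) :
    ∃ f : ℕ → ℤ, Set.InjOn f (Finset.Ico 1 (n + 1)) ∧
      ∀ x y : Fin n, f (x + 1) < f (y + 1) ↔ π.symm x < π.symm y := by
  refine ⟨fun x => if h : x - 1 < n then ((π.symm ⟨x - 1, h⟩ : Fin n) : ℤ) else 0, ?_, by simp⟩
  intro x hx y hy e
  simp only [Finset.coe_Ico, Set.mem_Ico] at hx hy
  have hx' : x - 1 < n := by omega
  have hy' : y - 1 < n := by omega
  simp only [hx', hy', dif_pos, Nat.cast_inj, Fin.val_inj, EmbeddingLike.apply_eq_iff_eq,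
    Fin.mk.injEq] at e
  omega

theorem exists_perm_of_labelling {n : ℕ} {f : ℕ → ℤ} (hf : Set.InjOn f (Finset.Ico 1 (n + 1))) :
    ∃ π : Equiv.Perm (Fin n), ∀ x y : Fin n, f (x + 1) < f (y + 1) ↔ π.symm x < π.symm y := by
  let g : Fin n → ℤ := fun x => f (x + 1)
  have hg : Function.Injective g := fun x y e => by
    have := hf (by simp) (by simp) e
    omega
  have hmono : StrictMono (g ∘ Tuple.sort g) :=
    (Tuple.monotone_sort g).strictMono_of_injective (hg.comp (Tuple.sort g).injective)
  refine ⟨Tuple.sort g, fun x y => ?_⟩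
  rw [← hmono.lt_iff_lt]
  simp [g]

theorem dissection_phi (n : ℕ) (π : Equiv.Perm (Fin n)) :
    Dissection (n + 1) (Phi n (PosetPairs n π)) := by
  rintro _ ⟨a, b, ⟨h1, h2, h3, -⟩, h4, h5, rfl⟩
  simp only [IsDiag] at *
  omega

theorem edgeOf_phi_iff {n : ℕ} {π : Equiv.Perm (Fin n)} {f : ℕ → ℤ}
    (hf : ∀ x y : Fin n, f (x + 1) < f (y + 1) ↔ π.symm x < π.symm y) {u v : ℕ} (hu : 1 ≤ u)
    (huv : u < v) (hv : v ≤ n + 1) :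
    EdgeOf (n + 1) (Phi n (PosetPairs n π)) (u, v) ↔
      ConvexBlock (Finset.Ico 1 (n + 1)) f u v := by
  obtain ⟨v, rfl⟩ := Nat.exists_eq_add_of_le' (hu.trans huv.le)
  constructor
  · rintro (⟨a, b, ⟨-, -, -, h⟩, -, -, e⟩ | h)
    · obtain ⟨rfl, rfl⟩ : u = a ∧ v = b := by simpa using e
      exact (isInterval_ivl_iff hf _ _).1 h
    · intro x hx y hy z hz x1 x2 z1 z2 xy yz
      simp only [OuterEdge, Finset.mem_Ico] at h hx hy hz
      rcases h with h | h
      · have : x = z := by omega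
        subst this
        omega
      · omega
  · intro h
    by_cases ho : OuterEdge (n + 1) (u, v + 1)
    · exact Or.inr ho
    · simp only [OuterEdge] at ho
      exact Or.inl ⟨u, v, ⟨hu, by dsimp only; omega, by dsimp only; omega,
        (isInterval_ivl_iff hf _ _).2 h⟩, by omega, by omega, rfl⟩

theorem mem_posetPairs_iff {n : ℕ} (π : Equiv.Perm (Fin n)) (a b : ℕ) :
    (a, b) ∈ PosetPairs n π ↔ 1 ≤ a ∧ a ≤ b ∧ b ≤ n ∧
      EdgeOf (n + 1) (Phi n (PosetPairs n π)) (a, b + 1) := by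
  obtain ⟨f, -, hf⟩ := exists_labelling π
  have key : ∀ h : 1 ≤ a ∧ a ≤ b ∧ b ≤ n, IsInterval π (ivl n a b) ↔
      EdgeOf (n + 1) (Phi n (PosetPairs n π)) (a, b + 1) := fun h => by
    rw [edgeOf_phi_iff hf h.1 (by omega) (by omega), isInterval_ivl_iff hf]
  constructor
  · rintro ⟨h1, h2, h3, h4⟩
    exact ⟨h1, h2, h3, (key ⟨h1, h2, h3⟩).1 h4⟩
  · rintro ⟨h1, h2, h3, h4⟩
    exact ⟨h1, h2, h3, (key ⟨h1, h2, h3⟩).2 h4⟩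

theorem mem_of_edgeOf {m : ℕ} {D : Set (ℕ × ℕ)} {u v : ℕ} (h : EdgeOf m D (u, v))
    (hd : IsDiag m (u, v)) : (u, v) ∈ D := by
  refine h.resolve_right fun ho => ?_
  simp only [IsDiag, OuterEdge] at hd ho
  omega

theorem diagFramed_phi (n : ℕ) (π : Equiv.Perm (Fin n)) :
    DiagFramed (n + 1) (Phi n (PosetPairs n π)) := by
  obtain ⟨f, hinj, hf⟩ := exists_labelling π
  intro a b c d hab hbc hcd h1 h2
  have d1 := dissection_phi n π _ h1
  have d2 := dissection_phi n π _ h2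
  simp only [IsDiag] at d1 d2
  have c1 := (edgeOf_phi_iff hf (by omega) (by omega) (by omega)).1 (Or.inl h1)
  have c2 := (edgeOf_phi_iff hf (by omega) (by omega) (by omega)).1 (Or.inl h2)
  have ma : a ∈ Finset.Ico 1 (n + 1) := by simp; omega
  have mb : b ∈ Finset.Ico 1 (n + 1) := by simp; omega
  have mc : c ∈ Finset.Ico 1 (n + 1) := by simp; omega
  exact ⟨(edgeOf_phi_iff hf (by omega) (by omega) (by omega)).2
      (c1.diff_left hinj c2 mc hbc.le hcd),
    (edgeOf_phi_iff hf (by omega) (by omega) (by omega)).2 (c1.inter c2 hab.le hcd.le),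
    (edgeOf_phi_iff hf (by omega) (by omega) (by omega)).2
      (c1.diff_right hinj c2 ma hab hbc.le),
    (edgeOf_phi_iff hf (by omega) (by omega) (by omega)).2
      (c1.union hinj c2 mb hab.le hbc hcd.le)⟩

theorem not_hasQuadFace_phi (n : ℕ) (π : Equiv.Perm (Fin n)) :
    ¬ HasQuadFace (n + 1) (Phi n (PosetPairs n π)) := by
  obtain ⟨f, hinj, hf⟩ := exists_labelling π
  rintro ⟨a, b, c, d, ha, hab, hbc, hcd, hd, e1, e2, e3, e4, hno⟩
  rw [edgeOf_phi_iff hf (by omega) (by omega) (by omega)] at e1 e2 e3 e4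
  rcases e1.three_blocks hinj e2 e3 e4 hab.le hbc.le hcd.le with h | h
  · refine hno ⟨(a, c), mem_of_edgeOf ((edgeOf_phi_iff hf ha (by omega) (by omega)).2 h) ?_,
      by simp⟩
    simp only [IsDiag]
    omega
  · refine hno ⟨(b, d), mem_of_edgeOf
      ((edgeOf_phi_iff hf (by omega) (by omega) (by omega)).2 h) ?_, by simp⟩
    simp only [IsDiag]
    omega

theorem framedPolygon_of_dissection {n : ℕ} (hn : 0 < n) {D : Set (ℕ × ℕ)}
    (hD : Dissection (n + 1) D) (hfr : DiagFramed (n + 1) D) (hq : ¬ HasQuadFace (n + 1) D) :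
    FramedPolygon (Finset.Icc 1 (n + 1)) 1 (n + 1) (fun u v => EdgeOf (n + 1) D (u, v)) where
  left_mem := by simp
  right_mem := by simp
  lt := by omega
  bounds x hx := by simpa using hx
  top := Or.inr (Or.inr ⟨rfl, rfl⟩)
  adj u hu v hv huv hw := by
    simp only [Finset.mem_Icc] at hu hv hw
    have := hw (u + 1) (by omega)
    exact Or.inr (Or.inl ⟨hu.1, by dsimp only; omega, hv.2⟩)
  framed a ha b hb c hc d hd hab hbc hcd h1 h2 := by
    simp only [Finset.mem_Icc] at ha hb hc hd
    exact hfr a b c d hab hbc hcd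
      (mem_of_edgeOf h1 (by simp only [IsDiag]; omega))
      (mem_of_edgeOf h2 (by simp only [IsDiag]; omega))
  noQuad a ha b hb c hc d hd hab hbc hcd e1 e2 e3 e4 := by
    simp only [Finset.mem_Icc] at ha hb hc hd ⊢
    by_contra hn
    refine hq ⟨a, b, c, d, ha.1, hab, hbc, hcd, hd.2, e1, e2, e3, e4, ?_⟩
    rintro ⟨⟨p, q⟩, hp, hc'⟩
    have hpq := hD _ hp
    simp only [IsDiag] at hpq
    refine hn ?_
    by_cases h1 : (p, q) = (a, c)
    · exact Or.inl (Or.inl (h1 ▸ hp))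
    by_cases h2 : (p, q) = (b, d)
    · exact Or.inr (Or.inl (Or.inl (h2 ▸ hp)))
    · exact Or.inr (Or.inr ⟨p, by omega, q, by omega, by omega, Or.inl hp, by tauto⟩)

/-- Φ is a bijection from the set of interval posets with n minimal
elements onto the set of diagonally framed dissections of the convex (n+1)-gon with no
quadrilateral face. -/
theorem phi_bijective (n : ℕ) :
    Set.BijOn (Phi n) (IntervalPosets n)
      {D : Set (ℕ × ℕ) | Dissection (n + 1) D ∧ DiagFramed (n + 1) D ∧
        ¬ HasQuadFace (n + 1) D} := by
  refine ⟨?_, ?_, ?_⟩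
  · rintro _ ⟨π, rfl⟩
    exact ⟨dissection_phi n π, diagFramed_phi n π, not_hasQuadFace_phi n π⟩
  · rintro _ ⟨π, rfl⟩ _ ⟨σ, rfl⟩ e
    ext ⟨a, b⟩
    rw [mem_posetPairs_iff, mem_posetPairs_iff, e]
  · rintro D ⟨hD, hfr, hq⟩
    suffices H : ∃ π : Equiv.Perm (Fin n), ∀ u v, 1 ≤ u → u < v → v ≤ n + 1 →
        (EdgeOf (n + 1) (Phi n (PosetPairs n π)) (u, v) ↔ EdgeOf (n + 1) D (u, v)) by
      obtain ⟨π, hπ⟩ := H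
      refine ⟨PosetPairs n π, ⟨π, rfl⟩, Set.ext fun ⟨u, v⟩ => ⟨fun h => ?_, fun h => ?_⟩⟩
      · have hd := dissection_phi n π _ h
        exact mem_of_edgeOf ((hπ u v hd.1 (by have := hd.2.1; omega) hd.2.2.1).1 (Or.inl h)) hd
      · have hd := hD _ h
        exact mem_of_edgeOf ((hπ u v hd.1 (by have := hd.2.1; omega) hd.2.2.1).2 (Or.inl h)) hd
    rcases Nat.eq_zero_or_pos n with rfl | hn
    · exact ⟨1, fun u v _ _ _ => by omega⟩
    obtain ⟨f, hf⟩ := (framedPolygon_of_dissection hn hD hfr hq).exists_realizes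
    have hS : (Finset.Icc 1 (n + 1)).filter (· < n + 1) = Finset.Ico 1 (n + 1) := by
      ext x
      simp only [Finset.mem_filter, Finset.mem_Icc, Finset.mem_Ico]
      omega
    obtain ⟨π, hπ⟩ := exists_perm_of_labelling (hS ▸ hf.injOn)
    refine ⟨π, fun u v hu huv hv => ?_⟩
    rw [edgeOf_phi_iff hπ hu huv hv, ← hS]
    exact (hf.iff u (by simp; omega) v (by simp; omega) huv).symm
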